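/- arXiv:1908.10824 — 2 statements merged into one kernel-verified Lean document; each statement's English description precedes it below -/
import Mathlib

section
/- (Proposition 5: the Fisher metric is the Hessian of the potential, coordinate version.) Let ρ : ℝᵐ → Sym(n,ℝ) be an injective linear map and U ⊆ ℝᵐ open with ρ(ξ) positive definite for all ξ ∈ U. Define φ : ℝⁿ × U → ℝ by φ(θ,ξ) = ½(⟨θ, ρ(ξ)⁻¹ θ⟩ − log det ρ(ξ)), and for w = (θ,ξ) ∈ ℝⁿ × U and x ∈ ℝⁿ set ℓ(w, x) = ⟨θ, x⟩ − ½⟨x, ρ(ξ) x⟩ − φ(w) − (n/2) log(2π), and p(w, x) = exp(ℓ(w, x)). Then for every w ∈ ℝⁿ × U and all directions u, v ∈ ℝ^{n+m}: ∫_{ℝⁿ} (fderiv ℝ (ℓ(·, x)) w u) · (fderiv ℝ (ℓ(·, x)) w v) · p(w, x) dx = (iteratedFDeriv ℝ 2 φ w)(u, v); that is, the Fisher metric of the statistical model 𝒫ₙ^ρ in the coordinates (θ, ξ) equals the Hessian of φ, so φ is a potential of the Fisher metric with respect to the standard flat connection in these coordinates. -/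
/-!
STATEMENT 17 (Proposition 5): for the statistical model induced by a
matrix-valued linear injection ρ, the Fisher metric in the coordinates (θ,ξ)
equals the Hessian of the potential φ(θ,ξ) = ½(⟨θ, ρ(ξ)⁻¹θ⟩ − log det ρ(ξ)).
-/

open scoped BigOperators

open Matrix MeasureTheory in
theorem gaussian_sum_sq_integral {ι : Type*} [Fintype ι] (c : ι → ℝ) :
    Integrable (fun y : ι → ℝ => Real.exp (c ⬝ᵥ y - 1 / 2 * (y ⬝ᵥ y))) ∧
    ∫ y : ι → ℝ, Real.exp (c ⬝ᵥ y - 1 / 2 * (y ⬝ᵥ y)) =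
      Real.exp (1 / 2 * (c ⬝ᵥ c) + (Fintype.card ι : ℝ) / 2 * Real.log (2 * Real.pi)) := by
  have hb : 0 < ((1 / 2 : ℂ)).re := by norm_num
  have key : ∀ y : ι → ℝ, Complex.exp (-(1 / 2 : ℂ) * ∑ i, (y i : ℂ) ^ 2 + ∑ i, (c i : ℂ) * y i)
      = ((Real.exp (c ⬝ᵥ y - 1 / 2 * (y ⬝ᵥ y)) : ℝ) : ℂ) := by
    intro y
    simp only [dotProduct]
    push_cast
    congr 1
    simp only [pow_two]
    ring
  have hint := GaussianFourier.integrable_cexp_neg_mul_sum_add hb (fun i => (c i : ℂ))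
  have hval := GaussianFourier.integral_cexp_neg_mul_sum_add hb (fun i => (c i : ℂ))
  simp only [key] at hint hval
  refine ⟨by simpa only [RCLike.re_to_complex, Complex.ofReal_re] using hint.re, ?_⟩
  rw [integral_complex_ofReal] at hval
  apply Complex.ofReal_injective
  rw [hval, Complex.ofReal_exp]
  have h2pi : ((Real.pi : ℂ) / (1 / 2)) = ((2 * Real.pi : ℝ) : ℂ) := by push_cast; ring
  rw [h2pi, Complex.cpow_def_of_ne_zero (by exact_mod_cast (by positivity : 2 * Real.pi ≠ 0)),
    ← Complex.ofReal_log (by positivity), ← Complex.exp_add]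
  simp only [dotProduct]
  push_cast
  congr 1
  simp only [pow_two]
  ring

open Matrix MeasureTheory in
theorem gaussian_integral_of_posDef {n : ℕ} {A : Matrix (Fin n) (Fin n) ℝ} (hA : A.PosDef)
    (θ : Fin n → ℝ) :
    Integrable (fun x : Fin n → ℝ => Real.exp (θ ⬝ᵥ x - 1 / 2 * (x ⬝ᵥ A *ᵥ x))) ∧
    ∫ x : Fin n → ℝ, Real.exp (θ ⬝ᵥ x - 1 / 2 * (x ⬝ᵥ A *ᵥ x)) =
      Real.exp (1 / 2 * (θ ⬝ᵥ A⁻¹ *ᵥ θ - Real.log A.det)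
        + (n : ℝ) / 2 * Real.log (2 * Real.pi)) := by
  obtain ⟨B, hB⟩ : ∃ B : Matrix (Fin n) (Fin n) ℝ, A = Bᵀ * B := by
    open scoped MatrixOrder Matrix.Norms.L2Operator in
    obtain ⟨B, hB⟩ := CStarAlgebra.nonneg_iff_eq_star_mul_self.mp hA.posSemidef.nonneg
    exact ⟨B, by simpa [star_eq_conjTranspose] using hB⟩
  have hdetA : A.det = B.det ^ 2 := by rw [hB, det_mul, det_transpose, sq]
  have hB0 : B.det ≠ 0 := fun h => by simpa [hdetA, h] using hA.det_pos
  have hBu : IsUnit B.det := hB0.isUnit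
  have hBtu : IsUnit Bᵀ.det := by rwa [det_transpose]
  set η : Fin n → ℝ := Bᵀ⁻¹ *ᵥ θ with hη
  have hθ : θ = Bᵀ *ᵥ η := by rw [hη, mulVec_mulVec, mul_nonsing_inv _ hBtu, one_mulVec]
  have hηη : θ ⬝ᵥ A⁻¹ *ᵥ θ = η ⬝ᵥ η := by
    rw [hB, Matrix.mul_inv_rev, ← mulVec_mulVec, ← hη, dotProduct_mulVec, ← mulVec_transpose,
      transpose_nonsing_inv, ← hη]
  have hcomp : ∀ x, Real.exp (θ ⬝ᵥ x - 1 / 2 * (x ⬝ᵥ A *ᵥ x)) =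
      (fun y => Real.exp (η ⬝ᵥ y - 1 / 2 * (y ⬝ᵥ y))) (toLin' B x) := by
    intro x
    simp only [toLin'_apply]
    rw [hB, ← mulVec_mulVec, dotProduct_mulVec x, vecMul_transpose]
    nth_rw 1 [hθ]
    rw [dotProduct_mulVec η, ← mulVec_transpose]
  obtain ⟨hint, hval⟩ := gaussian_sum_sq_integral η
  have hmap := Real.map_matrix_volume_pi_eq_smul_volume_pi hB0
  have hmeas : Measurable (toLin' B) := (toLin' B).continuous_of_finiteDimensional.measurable
  have hint' : Integrable (fun y => Real.exp (η ⬝ᵥ y - 1 / 2 * (y ⬝ᵥ y)))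
      (Measure.map (toLin' B) volume) := by
    rw [hmap]
    exact hint.smul_measure ENNReal.ofReal_ne_top
  simp only [hcomp]
  refine ⟨hint'.comp_measurable hmeas, ?_⟩
  rw [← integral_map hmeas.aemeasurable hint'.aestronglyMeasurable, hmap, integral_smul_measure,
    hval, hηη, ENNReal.toReal_ofReal (abs_nonneg _), hdetA, smul_eq_mul, abs_inv,
    ← Real.exp_log (abs_pos.mpr hB0), ← Real.exp_neg, ← Real.exp_add, Real.log_abs, Real.log_pow,
    Fintype.card_fin]
  congr 1
  push_cast
  ring

theorem contDiffAt_matrix_det {E ι : Type*} [NormedAddCommGroup E] [NormedSpace ℝ E] [Fintype ι]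
    [DecidableEq ι] {k : WithTop ℕ∞} {M : E → Matrix ι ι ℝ} {w : E}
    (hM : ∀ i j, ContDiffAt ℝ k (fun w => M w i j) w) :
    ContDiffAt ℝ k (fun w => (M w).det) w := by
  simp only [Matrix.det_apply']
  exact ContDiffAt.sum fun σ _ => contDiffAt_const.mul (contDiffAt_prod fun i _ => hM _ _)

theorem contDiffAt_matrix_inv {E ι : Type*} [NormedAddCommGroup E] [NormedSpace ℝ E] [Fintype ι]
    [DecidableEq ι] {k : WithTop ℕ∞} {M : E → Matrix ι ι ℝ} {w : E}
    (hM : ∀ i j, ContDiffAt ℝ k (fun w => M w i j) w) (h0 : (M w).det ≠ 0) (i j : ι) :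
    ContDiffAt ℝ k (fun w => (M w)⁻¹ i j) w := by
  simp only [Matrix.inv_def, Matrix.smul_apply, Ring.inverse_eq_inv, smul_eq_mul,
    Matrix.adjugate_apply]
  refine ((contDiffAt_matrix_det hM).inv h0).mul (contDiffAt_matrix_det fun a b => ?_)
  by_cases ha : a = j
  · simpa [Matrix.updateRow_apply, ha] using contDiffAt_const
  · simpa [Matrix.updateRow_apply, ha] using hM a b

/-- The second derivative of a `C²` function along a line is the diagonal of its Hessian. -/
theorem iteratedDeriv_two_comp_line {E : Type*} [NormedAddCommGroup E] [NormedSpace ℝ E]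
    {f : E → ℝ} {w : E} (hf : ContDiffAt ℝ 2 f w) (u : E) :
    deriv (fun t : ℝ => f (w + t • u)) 0 = fderiv ℝ f w u ∧
    iteratedDeriv 2 (fun t : ℝ => f (w + t • u)) 0 = fderiv ℝ (fderiv ℝ f) w u u := by
  have hline : ∀ t : ℝ, HasDerivAt (fun t : ℝ => w + t • u) u t := fun t => by
    simpa using ((hasDerivAt_id t).smul_const u).const_add w
  have hcont : Filter.Tendsto (fun t : ℝ => w + t • u) (nhds 0) (nhds w) := by
    simpa using (hline 0).continuousAt.tendsto
  have hd : ∀ᶠ t : ℝ in nhds 0,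
      deriv (fun t : ℝ => f (w + t • u)) t = fderiv ℝ f (w + t • u) u := by
    filter_upwards [hcont.eventually (hf.eventually (by simp))] with t ht
    exact ((ht.differentiableAt (by simp)).hasFDerivAt.comp_hasDerivAt t (hline t)).deriv
  refine ⟨by simpa using hd.self_of_nhds, ?_⟩
  rw [iteratedDeriv_succ, iteratedDeriv_one, Filter.EventuallyEq.deriv_eq hd]
  have hdd : DifferentiableAt ℝ (fderiv ℝ f) (w + (0 : ℝ) • u) := by
    simpa using (hf.fderiv_right (m := 1) (by norm_num)).differentiableAt (by simp)
  have hderiv : HasDerivAt (fun t : ℝ => fderiv ℝ f (w + t • u))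
      (fderiv ℝ (fderiv ℝ f) (w + (0 : ℝ) • u) u) 0 :=
    hdd.hasFDerivAt.comp_hasDerivAt (0 : ℝ) (hline 0)
  rw [zero_smul, add_zero] at hderiv
  have happ := (ContinuousLinearMap.apply ℝ ℝ u).hasFDerivAt.comp_hasDerivAt (0 : ℝ) hderiv
  exact happ.deriv

open MeasureTheory ProbabilityTheory in
/-- In an exponential family with log-partition function `φ` (up to an additive constant `c`), the
score `T x u - fderiv ℝ φ w u` is square-integrable and its second moment is the second derivative
of `φ` in the direction `u`. -/
theorem exponentialFamily_score_sq {E Ω : Type*} [NormedAddCommGroup E] [NormedSpace ℝ E]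
    [MeasurableSpace Ω] {μ : Measure Ω} {T : Ω → E →ₗ[ℝ] ℝ} {φ : E → ℝ} {c : ℝ} {w : E}
    (hφ : ContDiffAt ℝ 2 φ w)
    (hint : ∀ᶠ w' in nhds w, Integrable (fun x => Real.exp (T x w' - φ w' - c)) μ)
    (hone : ∀ᶠ w' in nhds w, ∫ x, Real.exp (T x w' - φ w' - c) ∂μ = 1) (u : E) :
    Integrable (fun x => (T x u - fderiv ℝ φ w u) ^ 2 * Real.exp (T x w - φ w - c)) μ ∧
    ∫ x, (T x u - fderiv ℝ φ w u) ^ 2 * Real.exp (T x w - φ w - c) ∂μ =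
      fderiv ℝ (fderiv ℝ φ) w u u := by
  set p : Ω → ℝ := fun x => Real.exp (T x w - φ w - c) with hp
  set P : Measure Ω := μ.withDensity (fun x => ENNReal.ofReal (p x)) with hP
  have hp0 : ∀ x, 0 ≤ p x := fun x => (Real.exp_pos _).le
  have hpm : AEMeasurable (fun x => ENNReal.ofReal (p x)) μ :=
    hint.self_of_nhds.aestronglyMeasurable.aemeasurable.ennreal_ofReal
  have hlt : ∀ᵐ x ∂μ, ENNReal.ofReal (p x) < ⊤ := .of_forall fun _ => ENNReal.ofReal_lt_top
  have hPint : ∀ g : Ω → ℝ, Integrable g P ↔ Integrable (fun x => g x * p x) μ := fun g => by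
    rw [hP, integrable_withDensity_iff_integrable_smul₀' hpm hlt]
    simp only [ENNReal.toReal_ofReal (hp0 _), smul_eq_mul, mul_comm]
  have hPval : ∀ g : Ω → ℝ, ∫ x, g x ∂P = ∫ x, g x * p x ∂μ := fun g => by
    rw [hP, integral_withDensity_eq_integral_toReal_smul₀ hpm hlt]
    simp only [ENNReal.toReal_ofReal (hp0 _), smul_eq_mul, mul_comm]
  have : IsProbabilityMeasure P := ⟨by
    rw [hP, withDensity_apply _ MeasurableSet.univ, Measure.restrict_univ,
      ← ofReal_integral_eq_lintegral_ofReal hint.self_of_nhds (.of_forall hp0),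
      hone.self_of_nhds, ENNReal.ofReal_one]⟩
  set X : Ω → ℝ := fun x => T x u with hX
  have hshift : ∀ (s : ℝ) (x : Ω), Real.exp (s * X x) * p x =
      Real.exp (φ (w + s • u) - φ w) * Real.exp (T x (w + s • u) - φ (w + s • u) - c) := by
    intro s x
    rw [hp, hX, ← Real.exp_add, ← Real.exp_add, map_add, map_smul, smul_eq_mul]
    congr 1
    ring
  have hline : Filter.Tendsto (fun s : ℝ => w + s • u) (nhds 0) (nhds w) := by
    have : Continuous fun s : ℝ => w + s • u := by fun_prop
    simpa using this.tendsto 0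
  have hmem : 0 ∈ interior (integrableExpSet X P) := by
    rw [mem_interior_iff_mem_nhds]
    filter_upwards [hline.eventually hint] with s hs
    rw [integrableExpSet, Set.mem_ofPred_eq, hPint]
    simp only [hshift]
    exact hs.const_mul _
  have hcgf : cgf X P =ᶠ[nhds 0] fun s => φ (w + s • u) - φ w := by
    filter_upwards [hline.eventually hone] with s hs
    rw [cgf, mgf, hPval]
    simp only [hshift]
    rw [integral_const_mul, hs, mul_one, Real.log_exp]
  obtain ⟨hd1, hd2⟩ :=
    iteratedDeriv_two_comp_line (f := fun z => φ z - φ w) (hφ.sub contDiffAt_const) u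
  have hfd : fderiv ℝ (fun z => φ z - φ w) = fderiv ℝ φ := by
    ext1 z
    rw [fderiv_sub_const]
  rw [hfd] at hd1 hd2
  rw [← hcgf.deriv_eq] at hd1
  rw [← hcgf.iteratedDeriv_eq 2] at hd2
  have hL2 : MemLp (fun x => X x - fderiv ℝ φ w u) 2 P :=
    (memLp_of_mem_interior_integrableExpSet hmem 2).sub (memLp_const _)
  refine ⟨(hPint _).1 hL2.integrable_sq, ?_⟩
  rw [← hPval, ← hd2, iteratedDeriv_two_cgf_eq_integral hmem, hd1]
  simp [hX]

open MeasureTheory in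
/-- The Fisher metric of an exponential family is the Hessian of its log-partition function. -/
theorem exponentialFamily_fisher_eq_hessian {E Ω : Type*} [NormedAddCommGroup E] [NormedSpace ℝ E]
    [MeasurableSpace Ω] {μ : Measure Ω} {T : Ω → E →ₗ[ℝ] ℝ} {φ : E → ℝ} {c : ℝ} {w : E}
    (hφ : ContDiffAt ℝ 2 φ w)
    (hint : ∀ᶠ w' in nhds w, Integrable (fun x => Real.exp (T x w' - φ w' - c)) μ)
    (hone : ∀ᶠ w' in nhds w, ∫ x, Real.exp (T x w' - φ w' - c) ∂μ = 1) (u v : E) :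
    ∫ x, (T x u - fderiv ℝ φ w u) * (T x v - fderiv ℝ φ w v) * Real.exp (T x w - φ w - c) ∂μ =
      fderiv ℝ (fderiv ℝ φ) w u v := by
  obtain ⟨hi1, hv1⟩ := exponentialFamily_score_sq hφ hint hone (u + v)
  obtain ⟨hi2, hv2⟩ := exponentialFamily_score_sq hφ hint hone (u - v)
  have hsymm : fderiv ℝ (fderiv ℝ φ) w v u = fderiv ℝ (fderiv ℝ φ) w u v :=
    hφ.isSymmSndFDerivAt (by simp) v u
  have hpol : ∀ x, (T x u - fderiv ℝ φ w u) * (T x v - fderiv ℝ φ w v)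
        * Real.exp (T x w - φ w - c) =
      1 / 4 * ((T x (u + v) - fderiv ℝ φ w (u + v)) ^ 2 * Real.exp (T x w - φ w - c)
        - (T x (u - v) - fderiv ℝ φ w (u - v)) ^ 2 * Real.exp (T x w - φ w - c)) := by
    intro x
    simp only [map_add, map_sub]
    ring
  simp only [hpol]
  rw [integral_const_mul, integral_sub hi1 hi2, hv1, hv2]
  simp only [map_add, map_sub, add_apply, sub_apply, hsymm]
  ring

open MeasureTheory in
theorem statement17 (n m : ℕ)
    (ρ : (Fin m → ℝ) →ₗ[ℝ] Matrix (Fin n) (Fin n) ℝ)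
    (hρsym : ∀ ξ, (ρ ξ).IsSymm) (hρinj : Function.Injective ρ)
    (U : Set (Fin m → ℝ)) (hU : IsOpen U)
    (hpos : ∀ ξ ∈ U, (ρ ξ).PosDef)
    -- the potential φ
    (φ : (Fin n → ℝ) × (Fin m → ℝ) → ℝ)
    (hφ : ∀ w, φ w = (1/2) * ((∑ i, w.1 i * ((ρ w.2)⁻¹).mulVec w.1 i)
        - Real.log (ρ w.2).det))
    -- the log-likelihood ℓ and the density p = exp ℓ
    (L : (Fin n → ℝ) × (Fin m → ℝ) → (Fin n → ℝ) → ℝ)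
    (hL : ∀ w x, L w x = (∑ i, w.1 i * x i)
        - (1/2) * (∑ i, x i * (ρ w.2).mulVec x i)
        - φ w - ((n : ℝ) / 2) * Real.log (2 * Real.pi)) :
    ∀ w : (Fin n → ℝ) × (Fin m → ℝ), w.2 ∈ U →
      ∀ u v : (Fin n → ℝ) × (Fin m → ℝ),
        (∫ x : Fin n → ℝ,
            (fderiv ℝ (fun w' => L w' x) w u) * (fderiv ℝ (fun w' => L w' x) w v)
              * Real.exp (L w x))
          = iteratedFDeriv ℝ 2 φ w ![u, v] := by
  intro w hw u v
  have hcoord : ∀ i j, ContDiffAt ℝ 2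
      (fun w : (Fin n → ℝ) × (Fin m → ℝ) => ρ w.2 i j) w := fun i j => by
    exact (LinearMap.toContinuousLinearMap (Matrix.entryLinearMap ℝ ℝ i j ∘ₗ ρ ∘ₗ
      LinearMap.snd ℝ (Fin n → ℝ) (Fin m → ℝ))).contDiff.contDiffAt
  have hφ' : ContDiffAt ℝ 2 φ w := by
    have hdet := (hpos _ hw).det_pos.ne'
    have hfst : ∀ i, ContDiffAt ℝ 2 (fun w : (Fin n → ℝ) × (Fin m → ℝ) => w.1 i) w := by
      fun_prop
    rw [funext hφ]
    simp only [Matrix.mulVec, dotProduct]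
    exact contDiffAt_const.mul ((ContDiffAt.sum fun i _ => (hfst i).mul
      (ContDiffAt.sum fun j _ => (contDiffAt_matrix_inv hcoord hdet i j).mul (hfst j))).sub
        ((contDiffAt_matrix_det hcoord).log hdet))
  set c : ℝ := (n : ℝ) / 2 * Real.log (2 * Real.pi) with hc
  let T : (Fin n → ℝ) → (Fin n → ℝ) × (Fin m → ℝ) →ₗ[ℝ] ℝ := fun x =>
    { toFun := fun w => w.1 ⬝ᵥ x - 1 / 2 * (x ⬝ᵥ (ρ w.2).mulVec x)
      map_add' := fun a b => by
        simp only [Prod.fst_add, Prod.snd_add, map_add, add_dotProduct, Matrix.add_mulVec,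
          dotProduct_add]
        ring
      map_smul' := fun r a => by
        simp only [Prod.smul_fst, Prod.smul_snd, map_smul, smul_dotProduct, Matrix.smul_mulVec,
          dotProduct_smul, smul_eq_mul, RingHom.id_apply]
        ring }
  have hLT : ∀ w x, L w x = T x w - φ w - c := hL
  have hnhds : ∀ᶠ w' : (Fin n → ℝ) × (Fin m → ℝ) in nhds w, w'.2 ∈ U :=
    continuous_snd.continuousAt.eventually (hU.mem_nhds hw)
  have hexp : ∀ (w' : (Fin n → ℝ) × (Fin m → ℝ)) x, Real.exp (T x w' - φ w' - c) =
      Real.exp (-(φ w' + c)) * Real.exp (w'.1 ⬝ᵥ x - 1 / 2 * (x ⬝ᵥ (ρ w'.2).mulVec x)) := by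
    intro w' x
    rw [← Real.exp_add]
    congr 1
    change w'.1 ⬝ᵥ x - 1 / 2 * (x ⬝ᵥ (ρ w'.2).mulVec x) - φ w' - c = _
    ring
  have hint : ∀ᶠ w' in nhds w, Integrable (fun x => Real.exp (T x w' - φ w' - c)) := by
    filter_upwards [hnhds] with w' hw'
    simp only [hexp]
    exact (gaussian_integral_of_posDef (hpos _ hw') w'.1).1.const_mul _
  have hone : ∀ᶠ w' in nhds w, ∫ x, Real.exp (T x w' - φ w' - c) = 1 := by
    filter_upwards [hnhds] with w' hw'
    simp only [hexp]
    rw [integral_const_mul, (gaussian_integral_of_posDef (hpos _ hw') w'.1).2, ← Real.exp_add,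
      Real.exp_eq_one_iff, hφ w']
    simp only [dotProduct]
    ring
  have hscore : ∀ x a, fderiv ℝ (fun w' => L w' x) w a = T x a - fderiv ℝ φ w a := by
    intro x a
    simp only [hLT]
    have hTx : HasFDerivAt (fun w' => T x w') (LinearMap.toContinuousLinearMap (T x)) w :=
      (LinearMap.toContinuousLinearMap (T x)).hasFDerivAt
    have hsub : HasFDerivAt (fun w' => T x w' - φ w' - c)
        (LinearMap.toContinuousLinearMap (T x) - fderiv ℝ φ w) w :=
      (hTx.sub (hφ'.differentiableAt (by simp)).hasFDerivAt).sub_const c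
    rw [hsub.fderiv]
    rfl
  rw [iteratedFDeriv_two_apply]
  simp only [hscore]
  simp only [hLT]
  exact exponentialFamily_fisher_eq_hessian hφ' hint hone u v
end

section
/- (Theorem 8, coordinate version.) Let ρ : ℝ² → Sym(2,ℝ) be an injective linear map and U ⊆ ℝ² open and connected with ρ(ξ) positive definite for all ξ ∈ U, and let φ : V → ℝ, V = ℝ² × U ⊆ ℝ⁴, be given by φ(θ,ξ) = ½(⟨θ, ρ(ξ)⁻¹ θ⟩ − log det ρ(ξ)). Suppose W ⊆ ℝ⁴ is open, ψ : W → ℝ is smooth with positive definite Hessian at every point, the gradient map ∇φ sends V into W, and ∇ψ(∇φ(v)) = v for all v ∈ V (i.e. ψ is a Legendre dual potential of φ, so the coordinates η = ∇φ are affine coordinates for the dual connection D* and the Fisher metric g_ρ has Hessian potential ψ in the coordinates η). Then for every η ∈ ∇φ(V) and all 1 ≤ i, j ≤ 4: ∂_i∂_j (log det Hess ψ)(η) = 6 · ∂_i∂_j ψ(η). Equivalently, the second Koszul form of the Hessian structure (g_ρ, D*) satisfies β* = 3 g_ρ, i.e. (𝒫₂^ρ, g_ρ, D*) is Hesse–Einstein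 (and hence the tangent bundle T𝒫₂^ρ with the induced Kähler structure is Kähler–Einstein). -/
/-!
STATEMENT 19 (Theorem 8): for any injective linear ρ : ℝ² → Sym(2,ℝ) with
ρ(U) positive definite, the Hessian structure (g_ρ, D*) of the statistical
model 𝒫₂^ρ is Hesse–Einstein with β* = 3 g_ρ: in the dual affine coordinates
η = ∇φ, where ψ is the Legendre dual potential,
∂_i∂_j (log det Hess ψ)(η) = 6 ∂_i∂_j ψ(η).
-/

open scoped BigOperators

/-- The linear form on `ℝ⁴` with coefficients `c`. -/
noncomputable def coordForm (c : Fin 4 → ℝ) : (Fin 4 → ℝ) →L[ℝ] ℝ :=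
  ∑ i, c i • ContinuousLinearMap.proj i

theorem coordForm_apply (c v : Fin 4 → ℝ) : coordForm c v = ∑ i, c i * v i := by
  simp [coordForm]

section Pencil

variable (A B : Matrix (Fin 2) (Fin 2) ℝ)

/-- The `(i, j)` entry of the pencil `ξ₀ A + ξ₁ B` at `w = (θ, ξ)`. -/
def pencil (i j : Fin 2) (w : Fin 4 → ℝ) : ℝ := w 2 * A i j + w 3 * B i j

/-- The determinant of the pencil of symmetric matrices `ξ₀ A + ξ₁ B`. -/
def pencilDet (w : Fin 4 → ℝ) : ℝ :=
  pencil A B 0 0 w * pencil A B 1 1 w - pencil A B 0 1 w * pencil A B 0 1 w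

/-- The `(0, 0)` entry of the inverse pencil. -/
noncomputable def invP (w : Fin 4 → ℝ) : ℝ := pencil A B 1 1 w * (pencilDet A B w)⁻¹

/-- The `(0, 1)` entry of the inverse pencil. -/
noncomputable def invQ (w : Fin 4 → ℝ) : ℝ := -pencil A B 0 1 w * (pencilDet A B w)⁻¹

/-- The `(1, 1)` entry of the inverse pencil. -/
noncomputable def invR (w : Fin 4 → ℝ) : ℝ := pencil A B 0 0 w * (pencilDet A B w)⁻¹

/-- The first component of the inverse pencil applied to `θ`. -/
noncomputable def meanU (w : Fin 4 → ℝ) : ℝ := invP A B w * w 0 + invQ A B w * w 1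

/-- The second component of the inverse pencil applied to `θ`. -/
noncomputable def meanV (w : Fin 4 → ℝ) : ℝ := invQ A B w * w 0 + invR A B w * w 1

/-- The potential of the Fisher metric. -/
noncomputable def potential (w : Fin 4 → ℝ) : ℝ :=
  (1 / 2) * (w 0 * meanU A B w + w 1 * meanV A B w - Real.log (pencilDet A B w))

/-- The partial derivative of the potential in the direction of the symmetric matrix `C`. -/
noncomputable def gradXi (C : Matrix (Fin 2) (Fin 2) ℝ) (w : Fin 4 → ℝ) : ℝ :=
  (-1 / 2) * (C 0 0 * (meanU A B w * meanU A B w + invP A B w)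
    + 2 * C 0 1 * (meanU A B w * meanV A B w + invQ A B w)
    + C 1 1 * (meanV A B w * meanV A B w + invR A B w))

/-- The gradient of the potential. -/
noncomputable def potentialGrad (w : Fin 4 → ℝ) : Fin 4 → ℝ :=
  ![meanU A B w, meanV A B w, gradXi A B A w, gradXi A B B w]

variable {A B} {w : Fin 4 → ℝ}

theorem hasStrictFDerivAt_pencil (i j : Fin 2) :
    HasStrictFDerivAt (pencil A B i j) (coordForm ![0, 0, A i j, B i j]) w := by
  refine (((hasStrictFDerivAt_apply (𝕜 := ℝ) 2 w).mul_const (A i j)).add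
    ((hasStrictFDerivAt_apply (𝕜 := ℝ) 3 w).mul_const (B i j))).congr_fderiv ?_
  ext v
  simp [coordForm_apply, Fin.sum_univ_four]

theorem hasStrictFDerivAt_pencilDet :
    HasStrictFDerivAt (pencilDet A B) (coordForm ![0, 0,
      A 0 0 * pencil A B 1 1 w + A 1 1 * pencil A B 0 0 w - 2 * A 0 1 * pencil A B 0 1 w,
      B 0 0 * pencil A B 1 1 w + B 1 1 * pencil A B 0 0 w - 2 * B 0 1 * pencil A B 0 1 w]) w := by
  refine (((hasStrictFDerivAt_pencil 0 0).mul (hasStrictFDerivAt_pencil 1 1)).sub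
    ((hasStrictFDerivAt_pencil 0 1).mul (hasStrictFDerivAt_pencil 0 1))).congr_fderiv ?_
  ext v
  simp [coordForm_apply, Fin.sum_univ_four]
  ring

theorem hasStrictFDerivAt_log_pencilDet (hD : pencilDet A B w ≠ 0) :
    HasStrictFDerivAt (fun w => Real.log (pencilDet A B w)) (coordForm ![0, 0,
      A 0 0 * invP A B w + 2 * A 0 1 * invQ A B w + A 1 1 * invR A B w,
      B 0 0 * invP A B w + 2 * B 0 1 * invQ A B w + B 1 1 * invR A B w]) w := by
  refine (hasStrictFDerivAt_pencilDet.log hD).congr_fderiv ?_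
  ext v
  simp [coordForm_apply, Fin.sum_univ_four, invP, invQ, invR]
  ring

theorem hasStrictFDerivAt_pencilDet_inv (hD : pencilDet A B w ≠ 0) :
    HasStrictFDerivAt (fun w => (pencilDet A B w)⁻¹) (-((pencilDet A B w)⁻¹ • coordForm ![0, 0,
      A 0 0 * invP A B w + 2 * A 0 1 * invQ A B w + A 1 1 * invR A B w,
      B 0 0 * invP A B w + 2 * B 0 1 * invQ A B w + B 1 1 * invR A B w])) w := by
  refine ((hasStrictDerivAt_inv hD).comp_hasStrictFDerivAt w
    hasStrictFDerivAt_pencilDet).congr_fderiv ?_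
  ext v
  simp [coordForm_apply, Fin.sum_univ_four, invP, invQ, invR]
  ring

theorem hasStrictFDerivAt_invP (hD : pencilDet A B w ≠ 0) :
    HasStrictFDerivAt (invP A B) (-coordForm ![0, 0,
      A 0 0 * invP A B w ^ 2 + 2 * A 0 1 * invP A B w * invQ A B w + A 1 1 * invQ A B w ^ 2,
      B 0 0 * invP A B w ^ 2 + 2 * B 0 1 * invP A B w * invQ A B w + B 1 1 * invQ A B w ^ 2]) w := by
  refine ((hasStrictFDerivAt_pencil 1 1).mul
    (hasStrictFDerivAt_pencilDet_inv hD)).congr_fderiv ?_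
  ext v
  simp [coordForm_apply, Fin.sum_univ_four, invP, invQ, invR]
  field_simp
  simp only [pencilDet]
  ring

theorem hasStrictFDerivAt_invQ (hD : pencilDet A B w ≠ 0) :
    HasStrictFDerivAt (invQ A B) (-coordForm ![0, 0,
      A 0 0 * invP A B w * invQ A B w + A 0 1 * (invP A B w * invR A B w + invQ A B w ^ 2)
        + A 1 1 * invQ A B w * invR A B w,
      B 0 0 * invP A B w * invQ A B w + B 0 1 * (invP A B w * invR A B w + invQ A B w ^ 2)
        + B 1 1 * invQ A B w * invR A B w]) w := by
  refine ((hasStrictFDerivAt_pencil 0 1).neg.mul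
    (hasStrictFDerivAt_pencilDet_inv hD)).congr_fderiv ?_
  ext v
  simp [coordForm_apply, Fin.sum_univ_four, invP, invQ, invR]
  field_simp
  simp only [pencilDet]
  ring

theorem hasStrictFDerivAt_invR (hD : pencilDet A B w ≠ 0) :
    HasStrictFDerivAt (invR A B) (-coordForm ![0, 0,
      A 0 0 * invQ A B w ^ 2 + 2 * A 0 1 * invQ A B w * invR A B w + A 1 1 * invR A B w ^ 2,
      B 0 0 * invQ A B w ^ 2 + 2 * B 0 1 * invQ A B w * invR A B w + B 1 1 * invR A B w ^ 2]) w := by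
  refine ((hasStrictFDerivAt_pencil 0 0).mul
    (hasStrictFDerivAt_pencilDet_inv hD)).congr_fderiv ?_
  ext v
  simp [coordForm_apply, Fin.sum_univ_four, invP, invQ, invR]
  field_simp
  simp only [pencilDet]
  ring

theorem hasStrictFDerivAt_meanU (hD : pencilDet A B w ≠ 0) :
    HasStrictFDerivAt (meanU A B) (coordForm ![invP A B w, invQ A B w,
      -(invP A B w * (A 0 0 * meanU A B w + A 0 1 * meanV A B w)
        + invQ A B w * (A 0 1 * meanU A B w + A 1 1 * meanV A B w)),
      -(invP A B w * (B 0 0 * meanU A B w + B 0 1 * meanV A B w)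
        + invQ A B w * (B 0 1 * meanU A B w + B 1 1 * meanV A B w))]) w := by
  refine (((hasStrictFDerivAt_invP hD).mul (hasStrictFDerivAt_apply (𝕜 := ℝ) 0 w)).add
    ((hasStrictFDerivAt_invQ hD).mul (hasStrictFDerivAt_apply (𝕜 := ℝ) 1 w))).congr_fderiv ?_
  ext v
  simp [coordForm_apply, Fin.sum_univ_four, meanU, meanV]
  ring

theorem hasStrictFDerivAt_meanV (hD : pencilDet A B w ≠ 0) :
    HasStrictFDerivAt (meanV A B) (coordForm ![invQ A B w, invR A B w,
      -(invQ A B w * (A 0 0 * meanU A B w + A 0 1 * meanV A B w)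
        + invR A B w * (A 0 1 * meanU A B w + A 1 1 * meanV A B w)),
      -(invQ A B w * (B 0 0 * meanU A B w + B 0 1 * meanV A B w)
        + invR A B w * (B 0 1 * meanU A B w + B 1 1 * meanV A B w))]) w := by
  refine (((hasStrictFDerivAt_invQ hD).mul (hasStrictFDerivAt_apply (𝕜 := ℝ) 0 w)).add
    ((hasStrictFDerivAt_invR hD).mul (hasStrictFDerivAt_apply (𝕜 := ℝ) 1 w))).congr_fderiv ?_
  ext v
  simp [coordForm_apply, Fin.sum_univ_four, meanU, meanV]
  ring

theorem hasStrictFDerivAt_potential (hD : pencilDet A B w ≠ 0) :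
    HasStrictFDerivAt (potential A B) (coordForm (potentialGrad A B w)) w := by
  refine (((((hasStrictFDerivAt_apply (𝕜 := ℝ) 0 w).mul (hasStrictFDerivAt_meanU hD)).add
    ((hasStrictFDerivAt_apply (𝕜 := ℝ) 1 w).mul (hasStrictFDerivAt_meanV hD))).sub
    (hasStrictFDerivAt_log_pencilDet hD)).const_mul (1 / 2)).congr_fderiv ?_
  ext v
  simp [coordForm_apply, Fin.sum_univ_four, potentialGrad, gradXi, meanU, meanV]
  ring

variable (A B w) in
/-- The Hessian of the potential in the directions of two symmetric matrices. -/
noncomputable def hessXi (C C' : Matrix (Fin 2) (Fin 2) ℝ) : ℝ :=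
  invP A B w * (C 0 0 * meanU A B w + C 0 1 * meanV A B w)
      * (C' 0 0 * meanU A B w + C' 0 1 * meanV A B w)
    + invQ A B w * ((C 0 0 * meanU A B w + C 0 1 * meanV A B w)
        * (C' 0 1 * meanU A B w + C' 1 1 * meanV A B w)
      + (C' 0 0 * meanU A B w + C' 0 1 * meanV A B w)
        * (C 0 1 * meanU A B w + C 1 1 * meanV A B w))
    + invR A B w * (C 0 1 * meanU A B w + C 1 1 * meanV A B w)
      * (C' 0 1 * meanU A B w + C' 1 1 * meanV A B w)
    + ((invP A B w * C 0 0 + invQ A B w * C 0 1) * (invP A B w * C' 0 0 + invQ A B w * C' 0 1)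
      + (invP A B w * C 0 1 + invQ A B w * C 1 1) * (invQ A B w * C' 0 0 + invR A B w * C' 0 1)
      + (invP A B w * C' 0 1 + invQ A B w * C' 1 1) * (invQ A B w * C 0 0 + invR A B w * C 0 1)
      + (invQ A B w * C 0 1 + invR A B w * C 1 1)
        * (invQ A B w * C' 0 1 + invR A B w * C' 1 1)) / 2

theorem hasStrictFDerivAt_gradXi (C : Matrix (Fin 2) (Fin 2) ℝ) (hD : pencilDet A B w ≠ 0) :
    HasStrictFDerivAt (gradXi A B C) (coordForm ![
      -(invP A B w * (C 0 0 * meanU A B w + C 0 1 * meanV A B w)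
        + invQ A B w * (C 0 1 * meanU A B w + C 1 1 * meanV A B w)),
      -(invQ A B w * (C 0 0 * meanU A B w + C 0 1 * meanV A B w)
        + invR A B w * (C 0 1 * meanU A B w + C 1 1 * meanV A B w)),
      hessXi A B w C A, hessXi A B w C B]) w := by
  have hu := hasStrictFDerivAt_meanU hD
  have hv := hasStrictFDerivAt_meanV hD
  refine (((((hu.mul hu).add (hasStrictFDerivAt_invP hD)).const_mul (C 0 0)).add
    (((hu.mul hv).add (hasStrictFDerivAt_invQ hD)).const_mul (2 * C 0 1))).add
    (((hv.mul hv).add (hasStrictFDerivAt_invR hD)).const_mul (C 1 1))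
    |>.const_mul (-1 / 2)).congr_fderiv ?_
  ext v
  simp [coordForm_apply, Fin.sum_univ_four, hessXi]
  ring

variable (A B w) in
/-- The Hessian matrix of the potential. -/
noncomputable def potentialHess : Matrix (Fin 4) (Fin 4) ℝ :=
  !![invP A B w, invQ A B w,
      -(invP A B w * (A 0 0 * meanU A B w + A 0 1 * meanV A B w)
        + invQ A B w * (A 0 1 * meanU A B w + A 1 1 * meanV A B w)),
      -(invP A B w * (B 0 0 * meanU A B w + B 0 1 * meanV A B w)
        + invQ A B w * (B 0 1 * meanU A B w + B 1 1 * meanV A B w));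
    invQ A B w, invR A B w,
      -(invQ A B w * (A 0 0 * meanU A B w + A 0 1 * meanV A B w)
        + invR A B w * (A 0 1 * meanU A B w + A 1 1 * meanV A B w)),
      -(invQ A B w * (B 0 0 * meanU A B w + B 0 1 * meanV A B w)
        + invR A B w * (B 0 1 * meanU A B w + B 1 1 * meanV A B w));
    -(invP A B w * (A 0 0 * meanU A B w + A 0 1 * meanV A B w)
        + invQ A B w * (A 0 1 * meanU A B w + A 1 1 * meanV A B w)),
      -(invQ A B w * (A 0 0 * meanU A B w + A 0 1 * meanV A B w)
        + invR A B w * (A 0 1 * meanU A B w + A 1 1 * meanV A B w)),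
      hessXi A B w A A, hessXi A B w A B;
    -(invP A B w * (B 0 0 * meanU A B w + B 0 1 * meanV A B w)
        + invQ A B w * (B 0 1 * meanU A B w + B 1 1 * meanV A B w)),
      -(invQ A B w * (B 0 0 * meanU A B w + B 0 1 * meanV A B w)
        + invR A B w * (B 0 1 * meanU A B w + B 1 1 * meanV A B w)),
      hessXi A B w B A, hessXi A B w B B]

theorem hasStrictFDerivAt_potentialGrad (hD : pencilDet A B w ≠ 0) :
    HasStrictFDerivAt (potentialGrad A B)
      (potentialHess A B w).mulVecLin.toContinuousLinearMap w := by
  refine hasStrictFDerivAt_pi'' fun i => ?_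
  have key (f : (Fin 4 → ℝ) → ℝ) (hf : f = fun x => potentialGrad A B x i)
      (h : HasStrictFDerivAt f (coordForm (potentialHess A B w i)) w) :
      HasStrictFDerivAt (fun x => potentialGrad A B x i) ((ContinuousLinearMap.proj i).comp
        (potentialHess A B w).mulVecLin.toContinuousLinearMap) w := by
    subst hf
    refine h.congr_fderiv ?_
    ext v
    simp [coordForm_apply, Matrix.mulVec, dotProduct]
  fin_cases i
  · exact key _ rfl (hasStrictFDerivAt_meanU hD)
  · exact key _ rfl (hasStrictFDerivAt_meanV hD)
  · exact key _ rfl (hasStrictFDerivAt_gradXi A hD)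
  · exact key _ rfl (hasStrictFDerivAt_gradXi B hD)

theorem det_potentialHess (hD : pencilDet A B w ≠ 0) :
    (potentialHess A B w).det =
      ((A 0 0 * B 1 1 + A 1 1 * B 0 0 - 2 * A 0 1 * B 0 1) ^ 2 / 4
        - (A 0 0 * A 1 1 - A 0 1 ^ 2) * (B 0 0 * B 1 1 - B 0 1 ^ 2)) / pencilDet A B w ^ 3 := by
  have hblock (p q r : ℝ) (hp : invP A B w = p) (hq : invQ A B w = q) (hr : invR A B w = r) :
      (potentialHess A B w).det = (p * r - q ^ 2) *
        (((p * A 0 0 + q * A 0 1) ^ 2 + 2 * (p * A 0 1 + q * A 1 1) * (q * A 0 0 + r * A 0 1)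
            + (q * A 0 1 + r * A 1 1) ^ 2) / 2
          * (((p * B 0 0 + q * B 0 1) ^ 2 + 2 * (p * B 0 1 + q * B 1 1) * (q * B 0 0 + r * B 0 1)
            + (q * B 0 1 + r * B 1 1) ^ 2) / 2)
          - (((p * A 0 0 + q * A 0 1) * (p * B 0 0 + q * B 0 1)
            + (p * A 0 1 + q * A 1 1) * (q * B 0 0 + r * B 0 1)
            + (p * B 0 1 + q * B 1 1) * (q * A 0 0 + r * A 0 1)
            + (q * A 0 1 + r * A 1 1) * (q * B 0 1 + r * B 1 1)) / 2) ^ 2) := by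
    simp only [potentialHess, hessXi, hp, hq, hr]
    simp [Matrix.det_succ_row_zero, Fin.sum_univ_succ, Fin.succAbove]
    ring
  rw [hblock _ _ _ rfl rfl rfl]
  simp only [invP, invQ, invR]
  field_simp
  simp only [pencilDet, pencil]
  ring

/-- Euler's identity for the potential. -/
theorem sum_potentialGrad_mul_sub_potential (hD : pencilDet A B w ≠ 0) :
    ∑ i, potentialGrad A B w i * w i - potential A B w
      = Real.log (pencilDet A B w) / 2 - 1 := by
  simp [Fin.sum_univ_four, potential, potentialGrad, gradXi, meanU, meanV]
  simp [invP, invQ, invR, pencil]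
  field_simp
  simp [pencilDet, pencil]
  ring

end Pencil

/-- A function with differential `⟨η, ·⟩` at `T η` has Legendre transform with partial
derivatives `T`. -/
theorem hasFDerivAt_legendre {ι : Type*} [Fintype ι] {f : (ι → ℝ) → ℝ}
    {T : (ι → ℝ) → ι → ℝ} {f' : (ι → ℝ) →L[ℝ] ℝ} {η : ι → ℝ} (hT : DifferentiableAt ℝ T η)
    (hf : HasFDerivAt f f' (T η)) (hf' : ∀ v, f' v = ∑ i, η i * v i) :
    HasFDerivAt (fun y => ∑ i, y i * T y i - f (T y))
      (∑ i, T η i • ContinuousLinearMap.proj (R := ℝ) (φ := fun _ => ℝ) i) η := by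
  have hTi (i : ι) : HasFDerivAt (fun y => T y i)
      ((ContinuousLinearMap.proj i).comp (fderiv ℝ T η)) η := hasFDerivAt_pi'.1 hT.hasFDerivAt i
  refine ((HasFDerivAt.fun_sum fun i _ => (hasFDerivAt_apply (𝕜 := ℝ) i η).mul (hTi i)).sub
    (hf.comp η hT.hasFDerivAt)).congr_fderiv ?_
  ext v
  simp [hf', Finset.sum_add_distrib]

/-- The differential of the gradient of a smooth function is its Hessian matrix. -/
theorem hasFDerivAt_partials {n : ℕ} {ψ : (Fin n → ℝ) → ℝ} {η : Fin n → ℝ}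
    (hψ : ContDiffAt ℝ 2 ψ η) (H : Matrix (Fin n) (Fin n) ℝ)
    (hH : ∀ i j, H i j = fderiv ℝ (fun y => fderiv ℝ ψ y (Pi.single i 1)) η (Pi.single j 1)) :
    HasFDerivAt (fun y i => fderiv ℝ ψ y (Pi.single i 1))
      H.mulVecLin.toContinuousLinearMap η := by
  refine hasFDerivAt_pi'' fun i => ?_
  have hd : DifferentiableAt ℝ (fun y => fderiv ℝ ψ y (Pi.single i 1)) η :=
    ((hψ.fderiv_right (m := 1) (by norm_num)).differentiableAt one_ne_zero).clm_apply
      (differentiableAt_const _)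
  refine hd.hasFDerivAt.congr_fderiv ?_
  refine ContinuousLinearMap.coe_injective ((Pi.basisFun ℝ (Fin n)).ext fun j => ?_)
  simp [hH]

theorem map_pair_eq (ρ : (Fin 2 → ℝ) →ₗ[ℝ] Matrix (Fin 2) (Fin 2) ℝ) (x y : ℝ) :
    ρ ![x, y] = x • ρ ![1, 0] + y • ρ ![0, 1] := by
  rw [← map_smul, ← map_smul, ← map_add]
  simp

section Bridge

variable {ρ : (Fin 2 → ℝ) →ₗ[ℝ] Matrix (Fin 2) (Fin 2) ℝ}

theorem map_pair_apply (w : Fin 4 → ℝ) (i j : Fin 2) :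
    ρ ![w 2, w 3] i j = pencil (ρ ![1, 0]) (ρ ![0, 1]) i j w := by
  simp [map_pair_eq ρ (w 2) (w 3), pencil]

theorem det_map_pair (hρ : ∀ ξ, (ρ ξ).IsSymm) (w : Fin 4 → ℝ) :
    (ρ ![w 2, w 3]).det = pencilDet (ρ ![1, 0]) (ρ ![0, 1]) w := by
  rw [Matrix.det_fin_two, (hρ _).apply 0 1]
  simp only [map_pair_apply, pencilDet]

theorem quadraticForm_inv_map_pair (hρ : ∀ ξ, (ρ ξ).IsSymm) (w : Fin 4 → ℝ) :
    (1 / 2) * ((∑ i, (![w 0, w 1] : Fin 2 → ℝ) i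
        * ((ρ ![w 2, w 3])⁻¹).mulVec ![w 0, w 1] i) - Real.log (ρ ![w 2, w 3]).det)
      = potential (ρ ![1, 0]) (ρ ![0, 1]) w := by
  rw [Matrix.inv_def, Matrix.adjugate_fin_two, (hρ _).apply 0 1, Ring.inverse_eq_inv',
    det_map_pair hρ]
  simp only [map_pair_apply]
  simp [potential, meanU, meanV, invP, invQ, invR, Fin.sum_univ_two, Matrix.mulVec, dotProduct]
  ring

end Bridge

open Matrix in
theorem statement19
    (ρ : (Fin 2 → ℝ) →ₗ[ℝ] Matrix (Fin 2) (Fin 2) ℝ)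
    (hρsym : ∀ ξ, (ρ ξ).IsSymm) (hρinj : Function.Injective ρ)
    (U : Set (Fin 2 → ℝ)) (hU : IsOpen U) (hUconn : IsConnected U)
    (hpos : ∀ ξ ∈ U, (ρ ξ).PosDef)
    -- the potential φ(θ,ξ) = ½(⟨θ, ρ(ξ)⁻¹θ⟩ − log det ρ(ξ)), with
    -- θ = (w 0, w 1) and ξ = (w 2, w 3)
    (φ : (Fin 4 → ℝ) → ℝ)
    (hφ : ∀ w : Fin 4 → ℝ,
      φ w = (1/2) * ((∑ i, (![w 0, w 1] : Fin 2 → ℝ) i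
            * ((ρ ![w 2, w 3])⁻¹).mulVec ![w 0, w 1] i)
        - Real.log (ρ ![w 2, w 3]).det))
    -- V = ℝ² × U as a subset of ℝ⁴
    (V : Set (Fin 4 → ℝ)) (hV : V = {w | (![w 2, w 3] : Fin 2 → ℝ) ∈ U})
    -- the gradient map ∇φ
    (gradφ : (Fin 4 → ℝ) → (Fin 4 → ℝ))
    (hgradφ : ∀ w i, gradφ w i = fderiv ℝ φ w (Pi.single i 1))
    -- the Legendre dual potential ψ on W, with positive definite Hessian Hψ
    (W : Set (Fin 4 → ℝ)) (hW : IsOpen W)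
    (ψ : (Fin 4 → ℝ) → ℝ) (hψ : ContDiffOn ℝ (⊤ : ℕ∞) ψ W)
    (Hψ : (Fin 4 → ℝ) → Matrix (Fin 4) (Fin 4) ℝ)
    (hHψ : ∀ η i j, Hψ η i j
      = fderiv ℝ (fun y => fderiv ℝ ψ y (Pi.single i 1)) η (Pi.single j 1))
    (hHpos : ∀ η ∈ W, (Hψ η).PosDef)
    -- ∇φ maps V into W and ψ is a Legendre dual of φ: ∇ψ ∘ ∇φ = id on V
    (hmap : ∀ w ∈ V, gradφ w ∈ W)
    (hLegendre : ∀ w ∈ V,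
      (fun i => fderiv ℝ ψ (gradφ w) (Pi.single i 1)) = w) :
    ∀ w ∈ V, ∀ i j : Fin 4,
      fderiv ℝ (fun y =>
          fderiv ℝ (fun z => Real.log (Hψ z).det) y (Pi.single i 1))
          (gradφ w) (Pi.single j 1)
        = 6 * Hψ (gradφ w) i j := by
  set A := ρ ![1, 0]
  set B := ρ ![0, 1]
  have hVopen : IsOpen V := by
    rw [hV]
    refine hU.preimage (continuous_pi fun i => ?_)
    fin_cases i
    · exact continuous_apply 2
    · exact continuous_apply 3
  have hD (w) (hw : w ∈ V) : 0 < pencilDet A B w := by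
    rw [← det_map_pair hρsym]
    exact (hpos _ (by simpa [hV] using hw)).det_pos
  obtain rfl : φ = potential A B :=
    funext fun w => (hφ w).trans (quadraticForm_inv_map_pair hρsym w)
  have hgrad (w) (hw : w ∈ V) : gradφ w = potentialGrad A B w := by
    ext i
    rw [hgradφ, (hasStrictFDerivAt_potential (hD w hw).ne').hasFDerivAt.fderiv]
    simp [coordForm_apply, Pi.single_apply]
  set T : (Fin 4 → ℝ) → Fin 4 → ℝ := fun y i => fderiv ℝ ψ y (Pi.single i 1) with hTdef
  have hT (y) (hy : y ∈ W) : HasFDerivAt T (Hψ y).mulVecLin.toContinuousLinearMap y :=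
    hasFDerivAt_partials (((hψ.contDiffAt (hW.mem_nhds hy))).of_le (WithTop.coe_le_coe.2 (le_top : (2 : ℕ∞) ≤ ⊤))) _
      (hHψ y)
  have hG (w) (hw : w ∈ V) :
      HasStrictFDerivAt gradφ (potentialHess A B w).mulVecLin.toContinuousLinearMap w :=
    (hasStrictFDerivAt_potentialGrad (hD w hw).ne').congr_of_eventuallyEq
      (Filter.eventually_of_mem (hVopen.mem_nhds hw) fun x hx => (hgrad x hx).symm)
  have hmul (w) (hw : w ∈ V) : Hψ (gradφ w) * potentialHess A B w = 1 := by
    have hcomp := (hT _ (hmap w hw)).comp w (hG w hw).hasFDerivAt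
    have hid : HasFDerivAt (T ∘ gradφ) (ContinuousLinearMap.id ℝ _) w :=
      (hasFDerivAt_id w).congr_of_eventuallyEq
        (Filter.eventually_of_mem (hVopen.mem_nhds hw) hLegendre)
    have heq := hcomp.unique hid
    refine Matrix.ext_of_mulVec_single fun v => ?_
    rw [← Matrix.mulVec_mulVec, Matrix.one_mulVec]
    exact congrArg (fun L => L (Pi.single v 1)) heq
  set c : ℝ := (A 0 0 * B 1 1 + A 1 1 * B 0 0 - 2 * A 0 1 * B 0 1) ^ 2 / 4
    - (A 0 0 * A 1 1 - A 0 1 ^ 2) * (B 0 0 * B 1 1 - B 0 1 ^ 2)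
  have hlog (w) (hw : w ∈ V) : Real.log (Hψ (gradφ w)).det
      = 6 * (∑ i, gradφ w i * T (gradφ w) i - potential A B (T (gradφ w))) + (6 - Real.log c) := by
    have hdet := congrArg Matrix.det (hmul w hw)
    rw [Matrix.det_mul, Matrix.det_one, det_potentialHess (hD w hw).ne'] at hdet
    have hc : c ≠ 0 := by
      intro h
      simp [c] at h
      simp [h] at hdet
    have hTw : T (gradφ w) = w := hLegendre w hw
    rw [hTw, eq_inv_of_mul_eq_one_left hdet, inv_div,
      Real.log_div (pow_ne_zero 3 (hD w hw).ne') hc, Real.log_pow, hgrad w hw,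
      sum_potentialGrad_mul_sub_potential (hD w hw).ne']
    push_cast
    ring
  intro w hw i j
  have himage : ∀ᶠ η in nhds (gradφ w), ∃ x ∈ V, gradφ x = η := by
    have hsurj : (potentialHess A B w).mulVecLin.toContinuousLinearMap.range = ⊤ := by
      rw [LinearMap.range_eq_top]
      intro v
      refine ⟨(Hψ (gradφ w)).mulVec v, ?_⟩
      simp [Matrix.mulVec_mulVec, mul_eq_one_comm.1 (hmul w hw)]
    rw [← (hG w hw).map_nhds_eq_of_surj hsurj]
    exact Filter.eventually_map.2
      (Filter.eventually_of_mem (hVopen.mem_nhds hw) fun x hx => ⟨x, hx, rfl⟩)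
  have heq : (fun z => Real.log (Hψ z).det) =ᶠ[nhds (gradφ w)]
      fun y => 6 * (∑ i, y i * T y i - potential A B (T y)) + (6 - Real.log c) := by
    filter_upwards [himage]
    rintro _ ⟨x, hx, rfl⟩
    exact hlog x hx
  have hfirst : (fun y => fderiv ℝ (fun z => Real.log (Hψ z).det) y (Pi.single i 1))
      =ᶠ[nhds (gradφ w)] fun y => 6 * fderiv ℝ ψ y (Pi.single i 1) := by
    filter_upwards [himage, heq.fderiv (𝕜 := ℝ)]
    rintro _ ⟨x, hx, rfl⟩ hy
    have hTx : T (gradφ x) = x := hLegendre x hx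
    have hL := hasFDerivAt_legendre (hT _ (hmap x hx)).differentiableAt
      (by rw [hTx]; exact (hasStrictFDerivAt_potential (hD x hx).ne').hasFDerivAt)
      (by simp [coordForm_apply, hgrad x hx])
    rw [hy, ((hL.const_mul 6).add_const _).fderiv]
    simp [hTdef, Pi.single_apply]
  rw [hfirst.fderiv_eq, hHψ, fderiv_const_mul]
  · simp
  · exact (hasFDerivAt_pi'.1 (hT _ (hmap w hw)) i).differentiableAt
end
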